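/- Let Z = U⁻¹ D U where U is an m×m unitary matrix and D is the real diagonal matrix with diagonal entries d = (d₁,…,d_m) ∈ ℝ^m. Then the Hilbert–Schmidt projection of Z onto the set of density matrices satisfies π_{S_m}(Z) = U⁻¹ J(π_{Δ_m}(d)) U, where J(v) denotes the diagonal matrix with diagonal entries v₁,…,v_m and π_{Δ_m}(d) is the Euclidean projection of d onto the probability simplex Δ_m ⊂ ℝ^m. -/

import Mathlib

open scoped BigOperators ENNReal
open MeasureTheory ProbabilityTheory Matrix
open scoped ComplexOrder

noncomputable section

abbrev Mat (m : ℕ) := Matrix (Fin m) (Fin m) ℂ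

namespace QST

variable {m : ℕ}

/-- Hilbert–Schmidt (Frobenius) norm `‖A‖₂`. -/
def frob (A : Mat m) : ℝ := Real.sqrt (∑ i, ∑ j, ‖A i j‖ ^ 2)

/-- Hilbert–Schmidt inner product `⟨A,B⟩ = Re tr(A B*)`. -/
def hsInner (A B : Mat m) : ℝ := (Matrix.trace (A * Bᴴ)).re

/-- Eigenvalues of a Hermitian matrix (junk value `0` otherwise). -/
def eigs (A : Mat m) : Fin m → ℝ :=
  if h : A.IsHermitian then h.eigenvalues else 0

/-- Operator (spectral) norm of a Hermitian matrix: the largest absolute value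
of an eigenvalue. -/
def opNorm (A : Mat m) : ℝ := ⨆ i, |eigs A i|

/-- Schatten `p`-norm, `p ∈ [1,∞]`. -/
def schatten (p : ℝ≥0∞) (A : Mat m) : ℝ :=
  if p = ∞ then opNorm A
  else (∑ i, |eigs A i| ^ p.toReal) ^ (1 / p.toReal)

/-- A density matrix: positive semidefinite (hence Hermitian) with unit trace. -/
def IsDensity (A : Mat m) : Prop := A.PosSemidef ∧ A.trace = 1

/-- The set `𝒮_m` of density matrices. -/
def Densities (m : ℕ) : Set (Mat m) := {A | IsDensity A}

/-- The set `𝒮_{m,δ} = {(1-δ) S + δ I/m : S ∈ 𝒮_m}`. -/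
def DensitiesReg (m : ℕ) (δ : ℝ) : Set (Mat m) :=
  {A | ∃ S, IsDensity S ∧ A = (1 - δ) • S + (δ / m) • (1 : Mat m)}

/-- `P` is the Hilbert–Schmidt projection of `Z` onto the set `C`. -/
def IsProjOn (C : Set (Mat m)) (Z P : Mat m) : Prop :=
  P ∈ C ∧ ∀ S ∈ C, frob (Z - P) ≤ frob (Z - S)

/-- Functional calculus for Hermitian matrices via the spectral decomposition
(junk value `0` for non-Hermitian matrices). -/
def hermApply (f : ℝ → ℝ) (A : Mat m) : Mat m :=
  if h : A.IsHermitian then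
    (h.eigenvectorUnitary : Mat m) *
      Matrix.diagonal (fun i => (f (h.eigenvalues i) : ℂ)) *
        (star (h.eigenvectorUnitary : Mat m))
  else 0

/-- Quantum relative entropy `K(S₁‖S₂) = tr(S₁ log S₁ - S₁ log S₂)`; the convention
`0 log 0 = 0` is automatic since `Real.log 0 = 0`. -/
def relEntropy (S₁ S₂ : Mat m) : ℝ :=
  (Matrix.trace (S₁ * hermApply Real.log S₁ - S₁ * hermApply Real.log S₂)).re

/-- Squared Bures distance `H²(S₁,S₂) = 2 - 2 tr √(√S₁ S₂ √S₁)`. -/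
def bures2 (S₁ S₂ : Mat m) : ℝ :=
  2 - 2 * (Matrix.trace (hermApply Real.sqrt
      (hermApply Real.sqrt S₁ * S₂ * hermApply Real.sqrt S₁))).re

/-- The probability simplex `Δ_m ⊂ ℝ^m`. -/
def simplex (m : ℕ) : Set (Fin m → ℝ) := {u | (∀ j, 0 ≤ u j) ∧ ∑ j, u j = 1}

/-- Euclidean norm on `ℝ^m`. -/
def e2 (x : Fin m → ℝ) : ℝ := Real.sqrt (∑ j, x j ^ 2)

/-- Supremum norm on `ℝ^m`. -/
def linf (x : Fin m → ℝ) : ℝ := ⨆ j, |x j|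

/-- `v` is the Euclidean projection of `z` onto the simplex `Δ_m`. -/
def IsProjSimplex (z v : Fin m → ℝ) : Prop :=
  v ∈ simplex m ∧ ∀ u ∈ simplex m, e2 (z - v) ≤ e2 (z - u)

/-- `E` is an orthonormal basis of the `m²`-dimensional real inner product space `ℍ_m`
of Hermitian `m×m` matrices (an orthonormal family of `m²` Hermitian matrices is
automatically a basis). -/
def IsONBasis (E : Fin (m ^ 2) → Mat m) : Prop :=
  (∀ k, (E k).IsHermitian) ∧
    ∀ k l, (Matrix.trace (E k * (E l)ᴴ)).re = if k = l then 1 else 0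


theorem frob_sq (A : Mat m) : frob A ^ 2 = ∑ i, ∑ j, ‖A i j‖ ^ 2 :=
  Real.sq_sqrt (Finset.sum_nonneg fun _ _ => Finset.sum_nonneg fun _ _ => sq_nonneg _)

theorem e2_sq (x : Fin m → ℝ) : e2 x ^ 2 = ∑ j, x j ^ 2 :=
  Real.sq_sqrt (Finset.sum_nonneg fun _ _ => sq_nonneg _)

theorem frob_eq_trace (A : Mat m) : frob A = Real.sqrt (Matrix.trace (A * Aᴴ)).re := by
  unfold frob
  congr 1
  simp [Matrix.trace, Matrix.mul_apply, Complex.mul_conj, Complex.normSq_eq_norm_sq,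
    -Complex.ofReal_pow]

/-- The Frobenius norm is invariant under unitary conjugation. -/
theorem frob_unitary_conj {U : Mat m} (hU : U ∈ Matrix.unitaryGroup (Fin m) ℂ) (A : Mat m) :
    frob (U * A * Uᴴ) = frob A := by
  have h : Uᴴ * U = 1 := Matrix.mem_unitaryGroup_iff'.mp hU
  rw [frob_eq_trace, frob_eq_trace]
  congr 2
  calc Matrix.trace (U * A * Uᴴ * (U * A * Uᴴ)ᴴ)
      = Matrix.trace (U * (A * (Uᴴ * U) * Aᴴ * Uᴴ)) := by
        simp only [conjTranspose_mul, conjTranspose_conjTranspose, Matrix.mul_assoc]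
    _ = Matrix.trace (A * (Uᴴ * U) * Aᴴ * (Uᴴ * U)) := by
        rw [Matrix.trace_mul_comm, Matrix.mul_assoc _ Uᴴ U]
    _ = Matrix.trace (A * Aᴴ) := by rw [h, Matrix.mul_one, Matrix.mul_one]

theorem IsDensity.conj_unitary {U S : Mat m} (hU : Uᴴ * U = 1) (hS : IsDensity S) :
    IsDensity (U * S * Uᴴ) := by
  refine ⟨hS.1.mul_mul_conjTranspose_same U, ?_⟩
  rw [Matrix.trace_mul_comm, ← Matrix.mul_assoc, hU, Matrix.one_mul, hS.2]

theorem IsDensity.apply_self_eq {S : Mat m} (hS : IsDensity S) (i : Fin m) :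
    S i i = ((S i i).re : ℂ) := by
  have h := (Complex.le_def.mp (hS.1.diag_nonneg (i := i))).2
  exact Complex.ext rfl (by simpa using h.symm)

theorem IsDensity.diag_mem_simplex {S : Mat m} (hS : IsDensity S) :
    (fun i => (S i i).re) ∈ simplex m := by
  refine ⟨fun i => (Complex.le_def.mp (hS.1.diag_nonneg (i := i))).1, ?_⟩
  simpa [Matrix.trace] using congrArg Complex.re hS.2

theorem isDensity_diagonal {w : Fin m → ℝ} (hw : w ∈ simplex m) :
    IsDensity (Matrix.diagonal (fun i => (w i : ℂ))) := by
  refine ⟨Matrix.PosSemidef.diagonal fun i => ?_, ?_⟩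
  · exact Complex.zero_le_real.mpr (hw.1 i)
  · rw [Matrix.trace_diagonal]
    exact_mod_cast hw.2

/-- The Euclidean projection onto the simplex is unique. -/
theorem IsProjSimplex.eq_of_e2_le {d w q : Fin m → ℝ} (hw : IsProjSimplex d w)
    (hq : q ∈ simplex m) (h : e2 (d - q) ≤ e2 (d - w)) : q = w := by
  have hmid : (fun i => (w i + q i) / 2) ∈ simplex m := by
    refine ⟨fun i => ?_, ?_⟩
    · have := hw.1.1 i
      have := hq.1 i
      positivity
    · rw [← Finset.sum_div, Finset.sum_add_distrib, hw.1.2, hq.2]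
      norm_num
  have h1 := pow_le_pow_left₀ (Real.sqrt_nonneg _) h 2
  have h2 := pow_le_pow_left₀ (Real.sqrt_nonneg _) (hw.2 _ hmid) 2
  change e2 _ ^ 2 ≤ e2 _ ^ 2 at h1 h2
  rw [e2_sq, e2_sq] at h1 h2
  have hpar : ∑ i, (d - fun i => (w i + q i) / 2) i ^ 2 =
      (∑ i, (d - w) i ^ 2) / 2 + (∑ i, (d - q) i ^ 2) / 2 - (∑ i, (q i - w i) ^ 2) / 4 := by
    simp only [Finset.sum_div, ← Finset.sum_add_distrib, ← Finset.sum_sub_distrib]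
    refine Finset.sum_congr rfl fun i _ => ?_
    simp only [Pi.sub_apply]
    ring
  have hzero : ∑ i, (q i - w i) ^ 2 = 0 :=
    le_antisymm (by linarith) (Finset.sum_nonneg fun _ _ => sq_nonneg _)
  funext i
  have := (Finset.sum_eq_zero_iff_of_nonneg fun _ _ => sq_nonneg _).mp hzero i (Finset.mem_univ i)
  exact sub_eq_zero.mp (pow_eq_zero_iff two_ne_zero |>.mp this)

theorem IsDensity.frob_diagonal_sub_sq {Q : Mat m} (hQ : IsDensity Q) (d : Fin m → ℝ) :
    frob (Matrix.diagonal (fun i => (d i : ℂ)) - Q) ^ 2 =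
      e2 (d - fun i => (Q i i).re) ^ 2 + ∑ i, ∑ j, if i = j then 0 else ‖Q i j‖ ^ 2 := by
  rw [frob_sq, e2_sq, ← Finset.sum_add_distrib]
  refine Finset.sum_congr rfl fun i _ => ?_
  rw [← Finset.add_sum_erase _ _ (Finset.mem_univ i),
    ← Finset.add_sum_erase _ (fun j => if i = j then _ else _) (Finset.mem_univ i), if_pos rfl,
    zero_add]
  congr 1
  · rw [Matrix.sub_apply, Matrix.diagonal_apply_eq, hQ.apply_self_eq i, ← Complex.ofReal_sub,
      Complex.norm_real, Real.norm_eq_abs, sq_abs]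
    rfl
  · refine Finset.sum_congr rfl fun j hj => ?_
    have hij : i ≠ j := (Finset.ne_of_mem_erase hj).symm
    rw [if_neg hij, Matrix.sub_apply, Matrix.diagonal_apply_ne _ hij, zero_sub, norm_neg]

theorem frob_diagonal_sub_diagonal (d w : Fin m → ℝ) :
    frob (Matrix.diagonal (fun i => (d i : ℂ)) - Matrix.diagonal (fun i => (w i : ℂ))) =
      e2 (d - w) := by
  unfold frob e2
  congr 1
  refine Finset.sum_congr rfl fun i _ => ?_
  rw [Finset.sum_eq_single i]
  · rw [Matrix.sub_apply, Matrix.diagonal_apply_eq, Matrix.diagonal_apply_eq,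
      ← Complex.ofReal_sub, Complex.norm_real, Real.norm_eq_abs, sq_abs, Pi.sub_apply]
  · intro j _ hj
    simp [Matrix.diagonal_apply_ne _ hj.symm]
  · simp

/-- A density matrix at least as close to a real diagonal matrix as the diagonal matrix of the
simplex projection is equal to the latter. -/
theorem IsDensity.eq_diagonal_of_frob_le {Q : Mat m} (hQ : IsDensity Q) {d w : Fin m → ℝ}
    (hw : IsProjSimplex d w)
    (h : frob (Matrix.diagonal (fun i => (d i : ℂ)) - Q) ≤ e2 (d - w)) :
    Q = Matrix.diagonal (fun i => (w i : ℂ)) := by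
  have hq := hQ.diag_mem_simplex
  have h1 := pow_le_pow_left₀ (Real.sqrt_nonneg _) h 2
  change frob _ ^ 2 ≤ _ at h1
  rw [hQ.frob_diagonal_sub_sq] at h1
  have hterm : ∀ i j, 0 ≤ if i = j then (0 : ℝ) else ‖Q i j‖ ^ 2 := by
    intro i j
    split_ifs <;> positivity
  have hoff : 0 ≤ ∑ i, ∑ j, if i = j then (0 : ℝ) else ‖Q i j‖ ^ 2 :=
    Finset.sum_nonneg fun i _ => Finset.sum_nonneg fun j _ => hterm i j
  have hqw := hw.eq_of_e2_le hq (pow_le_pow_iff_left₀ (Real.sqrt_nonneg _)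
    (Real.sqrt_nonneg _) two_ne_zero |>.mp (by change e2 _ ^ 2 ≤ e2 _ ^ 2; linarith))
  rw [hqw] at h1
  have hzero := le_antisymm (by linarith) hoff
  ext i j
  by_cases hij : i = j
  · subst hij
    rw [Matrix.diagonal_apply_eq, hQ.apply_self_eq i, ← hqw]
  · have hi := (Finset.sum_eq_zero_iff_of_nonneg fun i _ =>
      Finset.sum_nonneg fun j _ => hterm i j).mp hzero i (Finset.mem_univ i)
    have hj := (Finset.sum_eq_zero_iff_of_nonneg fun j _ => hterm i j).mp hi j (Finset.mem_univ j)
    rw [if_neg hij] at hj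
    rw [Matrix.diagonal_apply_ne _ hij]
    exact norm_eq_zero.mp (pow_eq_zero_iff two_ne_zero |>.mp hj)

/-- If `Z = U⁻¹ D U` with `U` unitary and `D` the real diagonal matrix with
diagonal `d`, then the Hilbert–Schmidt projection of `Z` onto the density matrices is
`U⁻¹ J(π_{Δ_m}(d)) U`, where `J(v)` is the diagonal matrix with diagonal `v`. -/
theorem stmt8 {m : ℕ} (U : Mat m) (hU : U ∈ Matrix.unitaryGroup (Fin m) ℂ)
    (d : Fin m → ℝ) (Z : Mat m)
    (hZ : Z = U⁻¹ * Matrix.diagonal (fun i => (d i : ℂ)) * U)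
    (w : Fin m → ℝ) (hw : IsProjSimplex d w)
    (P : Mat m) (hP : IsProjOn (Densities m) Z P) :
    P = U⁻¹ * Matrix.diagonal (fun i => (w i : ℂ)) * U := by
  have hl : Uᴴ * U = 1 := Matrix.mem_unitaryGroup_iff'.mp hU
  have hr : U * Uᴴ = 1 := Matrix.mem_unitaryGroup_iff.mp hU
  rw [Matrix.inv_eq_left_inv hl] at hZ ⊢
  have hcancel : ∀ A : Mat m, U * (Uᴴ * A * U) * Uᴴ = A := fun A => by
    calc U * (Uᴴ * A * U) * Uᴴ = (U * Uᴴ) * A * (U * Uᴴ) := by simp only [Matrix.mul_assoc]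
      _ = A := by rw [hr, Matrix.one_mul, Matrix.mul_one]
  have hconj : ∀ S : Mat m, frob (Z - S) =
      frob (Matrix.diagonal (fun i => (d i : ℂ)) - U * S * Uᴴ) := fun S => by
    rw [← frob_unitary_conj hU (Z - S), Matrix.mul_sub, Matrix.sub_mul, hZ, hcancel]
  have hW : IsDensity (Uᴴ * Matrix.diagonal (fun i => (w i : ℂ)) * U) := by
    simpa using (isDensity_diagonal hw.1).conj_unitary (U := Uᴴ) (by simpa using hr)
  have hle := hP.2 _ hW
  rw [hconj, hconj, hcancel, frob_diagonal_sub_diagonal] at hle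
  rw [← (hP.1.conj_unitary hl).eq_diagonal_of_frob_le hw hle]
  calc P = (Uᴴ * U) * P * (Uᴴ * U) := by rw [hl, Matrix.one_mul, Matrix.mul_one]
    _ = Uᴴ * (U * P * Uᴴ) * U := by simp only [Matrix.mul_assoc]

end QST
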